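/- Let s ∈ (0,1) and k > 0. Then there exists a constant C > 0 (depending on s and k) such that for every r > 1, ∫₀^∞ [ λ^s / (λ^{2s} − 2 λ^s k^{2s} cos(sπ) + k^{4s}) ] · (e^{−√λ · r} / (4π r)) dλ ≤ C r^{−3−2s}. -/

import Mathlib

open MeasureTheory Real
open scoped ENNReal

noncomputable section

/-- Completing the square: the Balakrishnan denominator is at least `k ^ (4 * s) * sin² (s π)`. -/
lemma le_balakrishnan_denominator (s k : ℝ) (hk : 0 < k) {l : ℝ} (hl : 0 < l) :
    k ^ (4 * s) * Real.sin (s * Real.pi) ^ 2 ≤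
      l ^ (2 * s) - 2 * l ^ s * k ^ (2 * s) * Real.cos (s * Real.pi) + k ^ (4 * s) := by
  have h1 : l ^ (2 * s) = (l ^ s) ^ 2 := by
    rw [← Real.rpow_mul_natCast hl.le]; congr 1; push_cast; ring
  have h2 : k ^ (4 * s) = (k ^ (2 * s)) ^ 2 := by
    rw [← Real.rpow_mul_natCast hk.le]; congr 1; push_cast; ring
  rw [h1, h2, Real.sin_sq]
  nlinarith [sq_nonneg (l ^ s - k ^ (2 * s) * Real.cos (s * Real.pi))]

/-- The Balakrishnan-type remainder estimate (`d = 3`): for `s ∈ (0,1)` and `k > 0`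
there is `C > 0` (depending on `s` and `k`) such that for all `r > 1`,
`∫₀^∞ λ^s / (λ^{2s} − 2λ^s k^{2s} cos(sπ) + k^{4s}) · e^{−√λ r}/(4π r) dλ ≤ C r^{−3−2s}`. -/
theorem balakrishnan_remainder_decay
    (s k : ℝ) (hs0 : 0 < s) (hs1 : s < 1) (hk : 0 < k) :
    ∃ C : ℝ, 0 < C ∧ ∀ r : ℝ, 1 < r →
      (∫ l in Set.Ioi (0 : ℝ),
          l ^ s / (l ^ (2 * s) - 2 * l ^ s * k ^ (2 * s) * Real.cos (s * Real.pi) + k ^ (4 * s)) *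
            (Real.exp (-(Real.sqrt l * r)) / (4 * Real.pi * r)))
        ≤ C * r ^ (-3 - 2 * s) := by
  have hsin : 0 < Real.sin (s * Real.pi) :=
    Real.sin_pos_of_pos_of_lt_pi (by positivity) (by nlinarith [Real.pi_pos])
  set c : ℝ := k ^ (4 * s) * Real.sin (s * Real.pi) ^ 2
  have hc : 0 < c := by positivity
  have hG : 0 < Real.Gamma ((s + 1) / (1 / 2)) := Real.Gamma_pos_of_pos (by positivity)
  refine ⟨1 / (c * (4 * Real.pi)) * (2 * Real.Gamma ((s + 1) / (1 / 2))), by positivity,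
    fun r hr => ?_⟩
  have hr0 : 0 < r := by linarith
  calc _ ≤ ∫ l in Set.Ioi (0 : ℝ),
        1 / (c * (4 * Real.pi * r)) * (l ^ s * Real.exp (-r * l ^ (1 / 2 : ℝ))) := by
        refine integral_mono_of_nonneg ?_ ?_ ?_
        · filter_upwards [ae_restrict_mem measurableSet_Ioi] with l hl
          have hl : 0 < l := hl
          have := hc.trans_le (le_balakrishnan_denominator s k hk hl)
          simp only [Pi.zero_apply]
          positivity
        · exact (integrableOn_rpow_mul_exp_neg_mul_rpow (by linarith) (by norm_num) hr0).const_mul _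
        · filter_upwards [ae_restrict_mem measurableSet_Ioi] with l hl
          have hl : 0 < l := hl
          have hD := le_balakrishnan_denominator s k hk hl
          calc _ ≤ l ^ s / c * (Real.exp (-(Real.sqrt l * r)) / (4 * Real.pi * r)) := by gcongr
            _ = _ := by
              rw [Real.sqrt_eq_rpow, show -r * l ^ (1 / 2 : ℝ) = -(l ^ (1 / 2 : ℝ) * r) by ring]
              field_simp
    _ = _ := by
        rw [integral_const_mul,
          integral_rpow_mul_exp_neg_mul_rpow (by norm_num) (by linarith) hr0,
          show -3 - 2 * s = -(s + 1) / (1 / 2) - 1 by ring, Real.rpow_sub_one hr0.ne']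
        field_simp
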